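/- For all l1, l2 ∈ ℝ, s1, s2 > 0 and w ∈ (0,1), the Kullback-Leibler divergence of the Cauchy density p_{l1,s1} from the mixture m = (1-w)*p_{l1,s1} + w*p_{l2,s2} equals log( ((l1-l2)^2 + (s1+s2)^2) / ( (1-w)*(s1^2 + s2^2 + (l1-l2)^2) + 2*w*s1*s2 + 2*sqrt(s1^2*s2^2 + s1*s2*((s1-s2)^2 + (l1-l2)^2)*w*(1-w)) ) ). -/

import Mathlib

open MeasureTheory Real

noncomputable def cauchyPdf (l s x : ℝ) : ℝ := s / (Real.pi * (s ^ 2 + (x - l) ^ 2))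

/-- The Cayley transform pulled back along `arctan`. -/
lemma cayley_eq (x : ℝ) :
    circleMap 0 1 (2 * arctan x) = (Complex.I - x) / (Complex.I + x) := by
  have hc : Complex.exp ((arctan x : ℂ) * Complex.I) =
      Real.cos (arctan x) * (1 + x * Complex.I) := by
    rw [Complex.exp_mul_I, ← Complex.ofReal_cos, ← Complex.ofReal_sin]
    have : Real.sin (arctan x) = x * Real.cos (arctan x) := by
      rw [Real.sin_arctan, Real.cos_arctan]; ring
    rw [this]; push_cast; ring
  have h2 : circleMap 0 1 (2 * arctan x) = Complex.exp ((arctan x : ℂ) * Complex.I) ^ 2 := by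
    rw [circleMap, ← Complex.exp_nat_mul]; push_cast; simp; ring_nf
  have h3 : ((Real.cos (arctan x) : ℝ) : ℂ) ^ 2 * (1 + (x : ℂ) ^ 2) = 1 := by
    have := Real.cos_sq_arctan x
    have hx : (1 + x ^ 2 : ℝ) ≠ 0 := by positivity
    have h : (Real.cos (arctan x)) ^ 2 * (1 + x ^ 2) = 1 := by
      rw [this]; field_simp
    exact_mod_cast h
  have hne : Complex.I + (x : ℂ) ≠ 0 := by
    intro h
    have := congrArg Complex.im h
    simp at this
  rw [h2, hc, eq_div_iff hne]
  have hI := Complex.I_sq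
  linear_combination (Complex.I - x) * h3 +
    ((Real.cos (arctan x) : ℝ) : ℂ) ^ 2 * ((2 * x) + Complex.I * x ^ 2 + x ^ 3) * hI

lemma circle_pull (a : ℂ) (ha : ‖a‖ ≤ 1) :
    Integrable (fun x : ℝ => (1 + x ^ 2)⁻¹ * Real.log ‖circleMap 0 1 (2 * arctan x) - a‖) ∧
    ∫ x : ℝ, (1 + x ^ 2)⁻¹ * Real.log ‖circleMap 0 1 (2 * arctan x) - a‖ = 0 := by
  have hpi := Real.pi_pos
  set g : ℝ → ℝ := fun t => Real.log ‖circleMap 0 1 t - a‖ with hg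
  have hper : Function.Periodic g (2 * π) := fun t => by
    simp only [hg, periodic_circleMap 0 1 t]
  have hint : IntervalIntegrable g volume 0 (2 * π) :=
    circleIntegrable_log_norm_sub_const (a := a) (c := 0) 1
  have hval : ∫ t in (0:ℝ)..(2 * π), g t = 0 := by
    have h := circleAverage_log_norm_sub_const_of_mem_closedBall (a := a) (c := 0) (R := 1)
      (by simpa using ha)
    rw [circleAverage_def, Real.log_one, smul_eq_mul] at h
    rcases mul_eq_zero.1 h with h | h
    · exact absurd h (by positivity)
    · exact h
  have hint2 : IntervalIntegrable g volume (-π) π := by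
    exact hper.intervalIntegrable₀ (by positivity) hint _ _
  have hval2 : ∫ t in (-π)..π, g t = 0 := by
    have := hper.intervalIntegral_add_eq (-π) 0
    rw [zero_add, hval] at this
    rw [← this]; congr 1; ring
  have hint3 : IntervalIntegrable (fun t => g (2 * t)) volume (-(π / 2)) (π / 2) := by
    have := hint2.comp_mul_left (c := 2)
    rwa [neg_div] at this
  have hval3 : ∫ t in (-(π / 2))..(π / 2), g (2 * t) = 0 := by
    rw [intervalIntegral.integral_comp_mul_left _ (two_ne_zero)]
    rw [show 2 * -(π / 2) = -π by ring, show 2 * (π / 2) = π by ring, hval2, smul_zero]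
  have hle : -(π / 2) ≤ π / 2 := by linarith
  have himg : arctan '' Set.univ = Set.Ioo (-(π / 2)) (π / 2) := by
    rw [Set.image_univ, Real.range_arctan]
  have hder : ∀ x ∈ (Set.univ : Set ℝ),
      HasDerivWithinAt arctan ((1 + x ^ 2)⁻¹) Set.univ x := fun x _ =>
    (Real.hasDerivAt_arctan' x).hasDerivWithinAt
  have hinj : Set.InjOn arctan Set.univ := Real.arctan_injective.injOn
  have habs : ∀ x : ℝ, |(1 + x ^ 2)⁻¹| = (1 + x ^ 2)⁻¹ := fun x => abs_of_pos (by positivity)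
  have e1 := integrableOn_image_iff_integrableOn_abs_deriv_smul MeasurableSet.univ hder hinj
    (fun t => g (2 * t))
  have e2 := integral_image_eq_integral_abs_deriv_smul MeasurableSet.univ hder hinj
    (fun t => g (2 * t))
  simp only [himg, habs, smul_eq_mul, integrableOn_univ, Measure.restrict_univ] at e1 e2
  refine ⟨e1.1 ?_, ?_⟩
  · exact ((intervalIntegrable_iff_integrableOn_Ioo_of_le hle).1 hint3)
  · rw [← e2, ← integral_Ioc_eq_integral_Ioo, ← intervalIntegral.integral_of_le hle, hval3]

lemma std_cauchy (l s : ℝ) (hs : 0 < s) :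
    Integrable (fun x : ℝ => (1 + x ^ 2)⁻¹ * Real.log (s ^ 2 + (x - l) ^ 2)) ∧
    ∫ x : ℝ, (1 + x ^ 2)⁻¹ * Real.log (s ^ 2 + (x - l) ^ 2) =
      π * Real.log ((1 + s) ^ 2 + l ^ 2) := by
  set ζ : ℂ := ⟨l, s⟩ with hζ
  set a : ℂ := (Complex.I - ζ) / (Complex.I + ζ) with ha
  have hn1 : ‖Complex.I + ζ‖ ^ 2 = (1 + s) ^ 2 + l ^ 2 := by
    rw [Complex.sq_norm, Complex.normSq_apply]; simp [hζ]; ring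
  have hn2 : ‖Complex.I - ζ‖ ^ 2 = (1 - s) ^ 2 + l ^ 2 := by
    rw [Complex.sq_norm, Complex.normSq_apply]; simp [hζ]; ring
  have hn0 : Complex.I + ζ ≠ 0 := by
    intro h
    have : (0:ℝ) < (1 + s) ^ 2 + l ^ 2 := by positivity
    rw [← hn1, h] at this
    simp at this
  have hpos := norm_pos_iff.2 hn0
  have han : ‖a‖ ≤ 1 := by
    rw [ha, norm_div, div_le_one hpos]
    refine (pow_le_pow_iff_left₀ (norm_nonneg _) hpos.le two_ne_zero).1 ?_
    rw [hn1, hn2]; nlinarith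
  obtain ⟨i1, v1⟩ := circle_pull a han
  obtain ⟨i2, v2⟩ := circle_pull (-1) (by simp)
  have key : ∀ x : ℝ, (1 + x ^ 2)⁻¹ * Real.log (s ^ 2 + (x - l) ^ 2) =
      (Real.log ((1 + s) ^ 2 + l ^ 2) * (1 + x ^ 2)⁻¹ +
        2 * ((1 + x ^ 2)⁻¹ * Real.log ‖circleMap 0 1 (2 * arctan x) - a‖)) -
        2 * ((1 + x ^ 2)⁻¹ * Real.log ‖circleMap 0 1 (2 * arctan x) - -1‖) := by
    intro x
    have hx : Complex.I + (x : ℂ) ≠ 0 := by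
      intro h
      have := congrArg Complex.im h
      simp at this
    have hζx : ζ - x ≠ 0 := by
      intro h
      have := congrArg Complex.im h
      simp [hζ] at this
      exact hs.ne' this
    have hb : circleMap 0 1 (2 * arctan x) - -1 = 2 * Complex.I / (Complex.I + x) := by
      rw [cayley_eq]; field_simp; ring
    have hb0 : circleMap 0 1 (2 * arctan x) - -1 ≠ 0 := by
      rw [hb]; exact div_ne_zero (by simp) hx
    have hm : (circleMap 0 1 (2 * arctan x) - a) * (Complex.I + ζ) =
        (circleMap 0 1 (2 * arctan x) - -1) * (ζ - x) := by
      rw [hb, cayley_eq, ha]; field_simp; ring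
    have ha0 : circleMap 0 1 (2 * arctan x) - a ≠ 0 := by
      intro h
      rw [h, zero_mul] at hm
      exact mul_ne_zero hb0 hζx hm.symm
    have hl := congrArg (fun z : ℂ => Real.log ‖z‖) hm
    simp only [norm_mul] at hl
    rw [Real.log_mul (norm_ne_zero_iff.2 ha0) (norm_ne_zero_iff.2 hn0),
      Real.log_mul (norm_ne_zero_iff.2 hb0) (norm_ne_zero_iff.2 hζx)] at hl
    have hq : s ^ 2 + (x - l) ^ 2 = ‖ζ - x‖ ^ 2 := by
      rw [Complex.sq_norm, Complex.normSq_apply]; simp [hζ]; ring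
    rw [hq, ← hn1, Real.log_pow, Real.log_pow]
    push_cast
    linear_combination (-2 * (1 + x ^ 2)⁻¹) * hl
  have i0 := integrable_inv_one_add_sq.const_mul (Real.log ((1 + s) ^ 2 + l ^ 2))
  have i01 := i0.add (i1.const_mul 2)
  rw [Pi.add_def] at i01
  simp only [key]
  refine ⟨i01.sub (i2.const_mul 2), ?_⟩
  rw [integral_sub i01 (i2.const_mul 2), integral_add i0 (i1.const_mul 2),
    integral_const_mul, integral_const_mul, integral_const_mul, v1, v2,
    integral_univ_inv_one_add_sq]
  ring

lemma gen_cauchy (l₁ s₁ l s : ℝ) (hs₁ : 0 < s₁) (hs : 0 < s) :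
    Integrable (fun x : ℝ => cauchyPdf l₁ s₁ x * Real.log (s ^ 2 + (x - l) ^ 2)) ∧
    ∫ x : ℝ, cauchyPdf l₁ s₁ x * Real.log (s ^ 2 + (x - l) ^ 2) =
      Real.log ((s₁ + s) ^ 2 + (l₁ - l) ^ 2) := by
  have hpi := Real.pi_pos
  obtain ⟨i, v⟩ := std_cauchy ((l - l₁) / s₁) (s / s₁) (by positivity)
  set F : ℝ → ℝ := fun x => cauchyPdf l₁ s₁ x * Real.log (s ^ 2 + (x - l) ^ 2) with hF
  have key : ∀ y : ℝ, F (s₁ * y + l₁) = (s₁ * π)⁻¹ * (Real.log (s₁ ^ 2) * (1 + y ^ 2)⁻¹ +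
      (1 + y ^ 2)⁻¹ * Real.log ((s / s₁) ^ 2 + (y - (l - l₁) / s₁) ^ 2)) := by
    intro y
    have h1 : s ^ 2 + (s₁ * y + l₁ - l) ^ 2 =
        s₁ ^ 2 * ((s / s₁) ^ 2 + (y - (l - l₁) / s₁) ^ 2) := by
      field_simp; ring
    have h2 : cauchyPdf l₁ s₁ (s₁ * y + l₁) = (s₁ * π)⁻¹ * (1 + y ^ 2)⁻¹ := by
      have : (1 + y ^ 2 : ℝ) ≠ 0 := by positivity
      rw [cauchyPdf, show s₁ ^ 2 + (s₁ * y + l₁ - l₁) ^ 2 = s₁ ^ 2 * (1 + y ^ 2) by ring]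
      field_simp
    simp only [hF]
    rw [h1, h2, Real.log_mul (by positivity) (by positivity)]
    ring
  have i0 := integrable_inv_one_add_sq.const_mul (Real.log (s₁ ^ 2))
  have iF : Integrable (fun y => F (s₁ * y + l₁)) := by
    simp only [key]
    exact (i0.add i).const_mul _
  have vF : ∫ y, F (s₁ * y + l₁) = s₁⁻¹ * Real.log ((s₁ + s) ^ 2 + (l₁ - l) ^ 2) := by
    simp only [key]
    rw [integral_const_mul, integral_add i0 i, integral_const_mul, v,
      integral_univ_inv_one_add_sq]
    have h1 : (s₁ + s) ^ 2 + (l₁ - l) ^ 2 =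
        s₁ ^ 2 * ((1 + s / s₁) ^ 2 + ((l - l₁) / s₁) ^ 2) := by
      field_simp; ring
    rw [h1, Real.log_mul (by positivity) (by positivity)]
    field_simp
  have hsub := Measure.integral_comp_mul_left (fun y => F (y + l₁)) s₁
  rw [integral_add_right_eq_self F l₁, vF, abs_of_pos (by positivity), smul_eq_mul] at hsub
  have hI : Integrable F := by
    have h1 := (integrable_comp_mul_left_iff (fun y => F (y + l₁)) hs₁.ne').1 iF
    have h2 := h1.comp_add_right (-l₁)
    simpa using h2
  exact ⟨hI, (mul_left_cancel₀ (by positivity) hsub).symm⟩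

theorem kl_cauchy_mixture (l₁ l₂ s₁ s₂ w : ℝ) (hs₁ : 0 < s₁) (hs₂ : 0 < s₂)
    (hw : w ∈ Set.Ioo (0 : ℝ) 1) :
    ∫ x : ℝ, cauchyPdf l₁ s₁ x *
        Real.log (cauchyPdf l₁ s₁ x / ((1 - w) * cauchyPdf l₁ s₁ x + w * cauchyPdf l₂ s₂ x))
      = Real.log (((l₁ - l₂) ^ 2 + (s₁ + s₂) ^ 2) /
          ((1 - w) * (s₁ ^ 2 + s₂ ^ 2 + (l₁ - l₂) ^ 2) + 2 * w * s₁ * s₂ +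
            2 * Real.sqrt (s₁ ^ 2 * s₂ ^ 2 +
              s₁ * s₂ * ((s₁ - s₂) ^ 2 + (l₁ - l₂) ^ 2) * w * (1 - w)))) := by
  obtain ⟨hw0, hw1⟩ := hw
  have hw1' : 0 < 1 - w := by linarith
  have hpi := Real.pi_pos
  set R := Real.sqrt (s₁ ^ 2 * s₂ ^ 2 +
              s₁ * s₂ * ((s₁ - s₂) ^ 2 + (l₁ - l₂) ^ 2) * w * (1 - w)) with hR
  have hRpos : 0 < R := Real.sqrt_pos.2 (by positivity)
  have hRsq : R ^ 2 = s₁ ^ 2 * s₂ ^ 2 +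
              s₁ * s₂ * ((s₁ - s₂) ^ 2 + (l₁ - l₂) ^ 2) * w * (1 - w) :=
    Real.sq_sqrt (by positivity)
  set a := (1 - w) * s₁ + w * s₂ with ha
  have hapos : 0 < a := by positivity
  set l := ((1 - w) * s₁ * l₂ + w * s₂ * l₁) / a with hl
  set s := R / a with hs
  have hspos : 0 < s := by positivity
  have hQ : ∀ x : ℝ, (1 - w) * s₁ * (s₂ ^ 2 + (x - l₂) ^ 2) + w * s₂ * (s₁ ^ 2 + (x - l₁) ^ 2) =
      a * (s ^ 2 + (x - l) ^ 2) := by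
    intro x
    have e : a * (s ^ 2 + (x - l) ^ 2) =
        (R ^ 2 + (a * x - ((1 - w) * s₁ * l₂ + w * s₂ * l₁)) ^ 2) / a := by
      rw [hs, hl]; field_simp
    rw [e, hRsq, eq_div_iff hapos.ne', ha]
    ring
  obtain ⟨i1, v1⟩ := gen_cauchy l₁ s₁ l₂ s₂ hs₁ hs₂
  obtain ⟨i2, v2⟩ := gen_cauchy l₁ s₁ l s hs₁ hspos
  have hpdf : ∀ x, cauchyPdf l₁ s₁ x = (s₁ / π) * (s₁ ^ 2 + (x - l₁) ^ 2)⁻¹ := by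
    intro x
    have : s₁ ^ 2 + (x - l₁) ^ 2 ≠ 0 := by positivity
    rw [cauchyPdf]; field_simp
  have h0 : Integrable (cauchyPdf l₁ s₁) ∧ ∫ x, cauchyPdf l₁ s₁ x = 1 := by
    have hf : cauchyPdf l₁ s₁ = ProbabilityTheory.cauchyPDFReal l₁ (Real.toNNReal s₁) := by
      funext x
      have : (x - l₁) ^ 2 + s₁ ^ 2 ≠ 0 := by positivity
      rw [hpdf, ProbabilityTheory.cauchyPDFReal_def, Real.coe_toNNReal _ hs₁.le, add_comm (s₁ ^ 2)]
      ring
    have hne : Real.toNNReal s₁ ≠ 0 := (Real.toNNReal_pos.2 hs₁).ne'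
    rw [hf]
    exact ⟨ProbabilityTheory.integrable_cauchyPDFReal _,
      ProbabilityTheory.integral_cauchyPDFReal_eq_one _ hne⟩
  obtain ⟨i0, v0⟩ := h0
  have key : ∀ x, cauchyPdf l₁ s₁ x *
        Real.log (cauchyPdf l₁ s₁ x / ((1 - w) * cauchyPdf l₁ s₁ x + w * cauchyPdf l₂ s₂ x)) =
      (Real.log (s₁ / a) * cauchyPdf l₁ s₁ x +
        cauchyPdf l₁ s₁ x * Real.log (s₂ ^ 2 + (x - l₂) ^ 2)) -
        cauchyPdf l₁ s₁ x * Real.log (s ^ 2 + (x - l) ^ 2) := by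
    intro x
    have hA : 0 < s₁ ^ 2 + (x - l₁) ^ 2 := by positivity
    have hB : 0 < s₂ ^ 2 + (x - l₂) ^ 2 := by positivity
    have hC : 0 < s ^ 2 + (x - l) ^ 2 := by positivity
    have e : cauchyPdf l₁ s₁ x / ((1 - w) * cauchyPdf l₁ s₁ x + w * cauchyPdf l₂ s₂ x) =
        s₁ / a * (s₂ ^ 2 + (x - l₂) ^ 2) / (s ^ 2 + (x - l) ^ 2) := by
      have e1 : s₁ / a * (s₂ ^ 2 + (x - l₂) ^ 2) / (s ^ 2 + (x - l) ^ 2) =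
          s₁ * (s₂ ^ 2 + (x - l₂) ^ 2) / (a * (s ^ 2 + (x - l) ^ 2)) := by
        field_simp
      rw [e1, ← hQ, cauchyPdf, cauchyPdf]
      generalize s₁ ^ 2 + (x - l₁) ^ 2 = A at hA
      generalize s₂ ^ 2 + (x - l₂) ^ 2 = B at hB
      have hd : (1 - w) * (s₁ / (π * A)) + w * (s₂ / (π * B)) =
        ((1 - w) * s₁ * B + w * s₂ * A) / (π * A * B) := by field_simp
      have : 0 < (1 - w) * s₁ * B + w * s₂ * A := by positivity
      rw [hd]
      field_simp
    rw [e, Real.log_div (by positivity) hC.ne', Real.log_mul (by positivity) hB.ne']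
    ring
  simp only [key]
  have i01 := (i0.const_mul (Real.log (s₁ / a))).add i1
  rw [Pi.add_def] at i01
  rw [integral_sub i01 i2, integral_add (i0.const_mul _) i1, integral_const_mul,
    v0, v1, v2, mul_one]
  have hden : (1 - w) * (s₁ ^ 2 + s₂ ^ 2 + (l₁ - l₂) ^ 2) + 2 * w * s₁ * s₂ + 2 * R =
      a / s₁ * ((s₁ + s) ^ 2 + (l₁ - l) ^ 2) := by
    have e1 := hQ l₁
    have e2 : a * s = R := by rw [hs]; field_simp
    rw [div_mul_eq_mul_div, eq_div_iff hs₁.ne']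
    have e3 : a = (1 - w) * s₁ + w * s₂ := ha
    linear_combination e1 - 2 * s₁ * e2 - s₁ ^ 2 * e3
  rw [hden, Real.log_div hs₁.ne' hapos.ne', Real.log_div (by positivity) (by positivity),
    Real.log_mul (by positivity) (by positivity),
    Real.log_div hapos.ne' hs₁.ne', add_comm ((l₁ - l₂) ^ 2)]
  ring
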